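/- Characterisation of no-signalling for a linear map on a bipartite matrix algebra (linearity argument underlying the proofs of the signalling lemmas): Let α, β, κ be finite types with decidable equality, Φ : Matrix (α × β) (α × β) ℂ →ₗ[ℂ] Matrix κ κ ℂ a linear map, and ρ₀ any fixed density matrix on α. Then the following are equivalent: (1) for every density matrix σ on α × β and every density matrix ρ on α, Φ σ = Φ (ρ ⊗ₖ ptr_α σ); (2) for every matrix X : Matrix (α × β) (α × β) ℂ, Φ X = Φ (ρ₀ ⊗ₖ ptr_α X). -/

import Mathlib

open Matrix Kronecker ComplexOrder

/-- A density matrix: positive semidefinite with unit trace. -/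
def IsDensity {n : Type} [Fintype n] (ρ : Matrix n n ℂ) : Prop :=
  ρ.PosSemidef ∧ ρ.trace = 1

/-- Partial trace over the first tensor factor. -/
noncomputable def ptrFst {μ ν : Type} [Fintype μ]
    (M : Matrix (μ × ν) (μ × ν) ℂ) : Matrix ν ν ℂ :=
  Matrix.of fun o p => ∑ k : μ, M (k, o) (k, p)

/-- Polarisation: every square matrix is a combination of four matrices of the form `Aᴴ * A`. -/
lemma Matrix.polarization_one {n : Type*} [Fintype n] [DecidableEq n] (X : Matrix n n ℂ) :
    (4 : ℂ) • X = (1 + X)ᴴ * (1 + X) - (1 - X)ᴴ * (1 - X)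
      - Complex.I • ((1 + Complex.I • X)ᴴ * (1 + Complex.I • X))
      + Complex.I • ((1 - Complex.I • X)ᴴ * (1 - Complex.I • X)) := by
  simp only [conjTranspose_add, conjTranspose_sub, conjTranspose_one, conjTranspose_smul,
    Complex.star_def, Complex.conj_I, add_mul, sub_mul, mul_add, mul_sub, one_mul, mul_one,
    Matrix.smul_mul, Matrix.mul_smul, smul_add, smul_sub, smul_smul]
  simp only [mul_neg, Complex.I_mul_I, neg_neg, neg_smul, one_smul]
  module

/-- The positive semidefinite matrices span all square complex matrices. -/
lemma Matrix.span_posSemidef {n : Type*} [Fintype n] [DecidableEq n] :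
    Submodule.span ℂ {A : Matrix n n ℂ | A.PosSemidef} = ⊤ := by
  refine Submodule.eq_top_iff'.2 fun X => ?_
  have h (A : Matrix n n ℂ) : Aᴴ * A ∈ Submodule.span ℂ {A : Matrix n n ℂ | A.PosSemidef} :=
    Submodule.subset_span (posSemidef_conjTranspose_mul_self A)
  rw [← Submodule.smul_mem_iff _ (four_ne_zero : (4 : ℂ) ≠ 0), Matrix.polarization_one]
  exact add_mem (sub_mem (sub_mem (h _) (h _)) (Submodule.smul_mem _ _ (h _)))
    (Submodule.smul_mem _ _ (h _))

/-- Density matrices span all square complex matrices. -/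
lemma span_isDensity {n : Type} [Fintype n] [DecidableEq n] :
    Submodule.span ℂ {A : Matrix n n ℂ | IsDensity A} = ⊤ := by
  rw [eq_top_iff, ← Matrix.span_posSemidef, Submodule.span_le]
  intro A (hA : A.PosSemidef)
  by_cases h : A.trace = 0
  · rw [hA.trace_eq_zero_iff.1 h]
    exact zero_mem _
  · rw [SetLike.mem_coe, ← Submodule.smul_mem_iff _ (inv_ne_zero h)]
    refine Submodule.subset_span ⟨hA.smul (inv_nonneg.2 hA.trace_nonneg), ?_⟩
    rw [trace_smul, smul_eq_mul, inv_mul_cancel₀ h]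

/-- The linear map `X ↦ ρ ⊗ₖ ptrFst X`. -/
noncomputable def replaceFst {μ ν : Type} [Fintype μ] (ρ : Matrix μ μ ℂ) :
    Matrix (μ × ν) (μ × ν) ℂ →ₗ[ℂ] Matrix (μ × ν) (μ × ν) ℂ where
  toFun X := ρ ⊗ₖ ptrFst X
  map_add' X Y := by
    ext
    simp [ptrFst, Finset.sum_add_distrib, mul_add]
  map_smul' c X := by
    ext
    simp [ptrFst, ← Finset.mul_sum, mul_left_comm]

lemma ptrFst_kronecker {μ ν : Type} [Fintype μ] (ρ : Matrix μ μ ℂ) (τ : Matrix ν ν ℂ) :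
    ptrFst (ρ ⊗ₖ τ) = ρ.trace • τ := by
  ext
  simp [ptrFst, Matrix.trace, Finset.sum_mul]

/-- **Characterisation of no-signalling for a linear map on a bipartite matrix algebra**
(linearity argument underlying the proofs of the signalling lemmas): the `α` subsystem
does not signal through `Φ` (condition on density matrices) iff `Φ` factors through the
partial trace over `α`, i.e. `Φ X = Φ (ρ₀ ⊗ₖ ptr_α X)` for all matrices `X` and any fixed
density matrix `ρ₀`. -/
theorem noSignalling_iff_factors_through_ptr
    {α β κ : Type} [Fintype α] [Fintype β] [Fintype κ]
    [DecidableEq α] [DecidableEq β] [DecidableEq κ]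
    (Φ : Matrix (α × β) (α × β) ℂ →ₗ[ℂ] Matrix κ κ ℂ)
    (ρ₀ : Matrix α α ℂ) (hρ₀ : IsDensity ρ₀) :
    (∀ σ : Matrix (α × β) (α × β) ℂ, IsDensity σ →
      ∀ ρ : Matrix α α ℂ, IsDensity ρ → Φ σ = Φ (ρ ⊗ₖ ptrFst σ))
    ↔
    (∀ X : Matrix (α × β) (α × β) ℂ, Φ X = Φ (ρ₀ ⊗ₖ ptrFst X)) := by
  constructor
  · intro h X
    have key : Φ = Φ ∘ₗ replaceFst ρ₀ :=
      LinearMap.ext_on span_isDensity fun σ hσ => h σ hσ ρ₀ hρ₀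
    exact LinearMap.congr_fun key X
  · intro h σ _ ρ hρ
    rw [h (ρ ⊗ₖ ptrFst σ), ptrFst_kronecker, hρ.2, one_smul, ← h σ]
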